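/- Every natural number n can be written as a sum of three triangular numbers: there exist natural numbers a, b, c such that n = a(a+1)/2 + b(b+1)/2 + c(c+1)/2. -/

import Mathlib

lemma exists_abs_two_mul_add_mul_le (a b : ℤ) (ha : 0 < a) : ∃ k : ℤ, |2 * (b + k * a)| ≤ a := by
  refine ⟨-((2 * b + a) / (2 * a)), abs_le.mpr ?_⟩
  have h₁ := Int.mul_ediv_add_emod (2 * b + a) (2 * a)
  have h₂ := Int.emod_nonneg (2 * b + a) (by positivity : 2 * a ≠ 0)
  have h₃ := Int.emod_lt_of_pos (2 * b + a) (by positivity : 0 < 2 * a)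
  constructor <;> linarith

/-- A positive definite ternary quadratic form with integer matrix of determinant one represents
only sums of three squares. -/
theorem ternary_form_eq_sum_three_sq (a b c r s t : ℤ) (ha : 0 < a) (hab : 0 < a * b - t ^ 2)
    (hdet : a * b * c + 2 * r * s * t - a * r ^ 2 - b * s ^ 2 - c * t ^ 2 = 1) (x y z : ℤ) :
    ∃ u v w : ℤ, a * x ^ 2 + b * y ^ 2 + c * z ^ 2 + 2 * r * y * z + 2 * s * x * z + 2 * t * x * y =
      u ^ 2 + v ^ 2 + w ^ 2 := by
  obtain ⟨k, hk⟩ := exists_abs_two_mul_add_mul_le (a * b - t ^ 2) (a * r - s * t) hab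
  obtain ⟨m, hm⟩ := exists_abs_two_mul_add_mul_le a t ha
  set A := a * b - t ^ 2 with hA
  set B := a * r - s * t + k * A with hB
  set C := a * (c + 2 * r * k + b * k ^ 2) - (s + t * k) ^ 2 with hC
  set T := t + m * a with hT
  set b' := b + 2 * t * m + a * m ^ 2 with hb'
  have hABC : A * C = a + B ^ 2 := by
    rw [hB, hC, hA]; linear_combination a * hdet
  have habT : a * b' = A + T ^ 2 := by rw [hb', hA, hT]; ring
  have hC0 : 0 < C := by
    by_contra! h
    nlinarith [sq_nonneg B]
  have hb0 : 0 < b' := by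
    by_contra! h
    nlinarith [sq_nonneg T]
  have hB2 : 4 * B ^ 2 ≤ A ^ 2 := by
    have := sq_le_sq' (abs_le.mp hk).1 (abs_le.mp hk).2
    linarith
  have hT2 : 4 * T ^ 2 ≤ a ^ 2 := by
    have := sq_le_sq' (abs_le.mp hm).1 (abs_le.mp hm).2
    linarith
  rcases lt_or_ge C A with hCA | hCA
  · obtain ⟨u, v, w, h⟩ := ternary_form_eq_sum_three_sq a (c + 2 * r * k + b * k ^ 2) b (r + b * k) t
      (s + t * k) ha hC0 (by linear_combination hdet) x z (y - k * z)
    exact ⟨u, v, w, by rw [← h]; ring⟩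
  rcases lt_or_ge b' a with hba | hba
  · obtain ⟨u, v, w, h⟩ := ternary_form_eq_sum_three_sq b' a c s (r + s * m) T hb0
      (by linarith) (by rw [hb', hT]; linear_combination hdet) y (x - m * y) z
    exact ⟨u, v, w, by rw [← h, hb', hT]; ring⟩
  have h₁ : 3 * A ^ 2 ≤ 4 * a := by nlinarith
  have h₂ : 3 * a ^ 2 ≤ 4 * A := by nlinarith
  have ha1 : a = 1 := by
    by_contra hne
    have : 2 ≤ a := by omega
    have : A < a := by nlinarith
    nlinarith
  rw [ha1] at h₁ hm
  have hA1 : A = 1 := by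
    by_contra hne
    have : 2 ≤ A := by omega
    nlinarith
  have hT0 : T = 0 := by
    have := abs_le.mp hm
    lia
  have ht : t = -m := by rw [hT, ha1] at hT0; linarith
  have hb : b = 1 + m ^ 2 := by rw [hA, ha1, ht] at hA1; linarith
  subst ha1 ht hb
  refine ⟨x - m * y + s * z, y + (r + m * s) * z, z, ?_⟩
  linear_combination z ^ 2 * hdet
termination_by (a.toNat, (a * b - t ^ 2).toNat)
decreasing_by
  · refine Prod.Lex.right _ ?_
    omega
  · refine Prod.Lex.left _ _ ?_
    omega

/-- If `-d` is a square modulo `d * n - 1`, then `n` is a sum of three squares. -/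
lemma sum_three_sq_of_dvd {n d x : ℤ} (hd : 0 < d) (hdn : 0 < d * n - 1)
    (h : d * n - 1 ∣ x ^ 2 + d) : ∃ u v w : ℤ, n = u ^ 2 + v ^ 2 + w ^ 2 := by
  obtain ⟨a, ha⟩ := h
  have ha0 : 0 < a := by
    by_contra! h
    nlinarith [sq_nonneg x]
  obtain ⟨u, v, w, h⟩ := ternary_form_eq_sum_three_sq a (d * n - 1) n 0 1 x ha0
    (by linarith) (by linear_combination -n * ha) 0 0 1
  exact ⟨u, v, w, by linarith⟩

lemma isSquare_neg_of_two_mul_add_one_eq_mul {p d N : ℕ} [Fact p.Prime] (hp : p % 4 = 1)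
    (hd : d % 8 = 1) (h : 2 * p + 1 = d * N) : IsSquare (-(d : ZMod p)) := by
  have hdo : Odd d := Nat.odd_iff.mpr (by omega)
  have h_neg : jacobiSym (-1) d = 1 := by
    rw [jacobiSym.at_neg_one hdo, ZMod.χ₄_nat_one_mod_four (by omega)]
  have h_two : jacobiSym 2 d = 1 := by
    rw [jacobiSym.at_two hdo, ZMod.χ₈_nat_eq_if_mod_eight]
    simp [hd, show d % 2 = 1 by omega]
  have h_mul : jacobiSym (2 * p) d = 1 := by
    rw [← h_neg]
    apply jacobiSym.mod_left'
    refine Int.emod_eq_emod_iff_emod_sub_eq_zero.mpr (Int.emod_eq_zero_of_dvd ⟨N, ?_⟩)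
    linear_combination (by exact_mod_cast h : (2 * p + 1 : ℤ) = d * N)
  have h_neg_p : jacobiSym (-1) p = 1 := by
    rw [jacobiSym.at_neg_one (Nat.odd_iff.mpr (by omega)), ZMod.χ₄_nat_one_mod_four hp]
  have h_p : jacobiSym (-(d : ℤ)) p = 1 := by
    rw [← neg_one_mul, jacobiSym.mul_left, h_neg_p, one_mul,
      jacobiSym.quadratic_reciprocity_one_mod_four' hdo hp]
    rwa [jacobiSym.mul_left, h_two, one_mul] at h_mul
  simpa using ZMod.isSquare_of_jacobiSym_eq_one h_p

/-- Every natural number congruent to three modulo eight is a sum of three squares. -/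
theorem eight_mul_add_three_eq_sum_three_sq (n : ℕ) :
    ∃ u v w : ℤ, 8 * (n : ℤ) + 3 = u ^ 2 + v ^ 2 + w ^ 2 := by
  have hcop : (4 * n + 1).Coprime (4 * (8 * n + 3)) := by
    refine Nat.Coprime.mul_right ?_ ?_
    · simp
    · rw [show 8 * n + 3 = 1 + (4 * n + 1) * 2 by ring]
      simp
  obtain ⟨p, hpn, hp, hmod⟩ := Nat.forall_exists_prime_gt_and_modEq (4 * n + 1) (by omega) hcop
  obtain ⟨j, hj⟩ := (Nat.modEq_iff_dvd' hpn.le).mp hmod.symm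
  have hpj : p = 4 * n + 1 + 4 * (8 * n + 3) * j := by omega
  have : Fact p.Prime := ⟨hp⟩
  have hp4 : p % 4 = 1 := by
    rw [hpj, mul_assoc]
    omega
  obtain ⟨x, hx⟩ := isSquare_neg_of_two_mul_add_one_eq_mul (p := p) (d := 8 * j + 1)
    (N := 8 * n + 3) hp4 (by omega) (by rw [hpj]; ring)
  obtain ⟨x, rfl⟩ := ZMod.intCast_surjective x
  have hdvd : (p : ℤ) ∣ x ^ 2 + (8 * j + 1) := by
    rw [← ZMod.intCast_zmod_eq_zero_iff_dvd]
    push_cast at hx ⊢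
    linear_combination -hx
  obtain ⟨y, hyodd, hy⟩ : ∃ y : ℤ, y % 2 = 1 ∧ (p : ℤ) ∣ y ^ 2 + (8 * j + 1) := by
    rcases Int.emod_two_eq_zero_or_one x with h | h
    · refine ⟨x + p, by omega, ?_⟩
      rw [show (x + p) ^ 2 + (8 * j + 1) = x ^ 2 + (8 * j + 1) + p * (2 * x + p) by ring]
      exact hdvd.add (dvd_mul_right _ _)
    · exact ⟨x, h, hdvd⟩
  have htwo : (2 : ℤ) ∣ y ^ 2 + (8 * j + 1) := by
    obtain ⟨q, hq⟩ : ∃ q, y = 2 * q + 1 := ⟨y / 2, by omega⟩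
    exact ⟨2 * q ^ 2 + 2 * q + 4 * j + 1, by rw [hq]; ring⟩
  have h2p : (8 * (j : ℤ) + 1) * (8 * n + 3) - 1 = 2 * p := by
    rw [hpj]
    push_cast
    ring
  refine sum_three_sq_of_dvd (d := 8 * j + 1) (x := y) (by positivity) ?_ ?_
  · rw [h2p]
    exact_mod_cast Nat.mul_pos two_pos hp.pos
  · rw [h2p]
    refine IsCoprime.mul_dvd ?_ htwo hy
    exact_mod_cast (Nat.coprime_two_left.mpr (Nat.odd_iff.mpr (by omega)) : Nat.Coprime 2 p)

lemma Int.exists_nat_sq_eq_two_mul_add_one_sq {u : ℤ} (hu : Odd u) :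
    ∃ a : ℕ, u ^ 2 = (2 * a + 1) ^ 2 := by
  obtain ⟨a, ha⟩ := Int.natAbs_odd.mpr hu
  refine ⟨a, ?_⟩
  rw [← Int.natAbs_sq, ha]
  push_cast
  rfl

lemma Int.odd_of_sum_three_sq_emod_eight_eq_three {u v w : ℤ}
    (h : (u ^ 2 + v ^ 2 + w ^ 2) % 8 = 3) : Odd u ∧ Odd v ∧ Odd w := by
  have hsq (x : ℤ) : Odd x ∧ x ^ 2 % 8 = 1 ∨ ¬ Odd x ∧ (x ^ 2 % 8 = 0 ∨ x ^ 2 % 8 = 4) := by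
    rcases Int.even_or_odd x with hx | hx
    · obtain ⟨k, rfl⟩ := hx.two_dvd
      refine Or.inr ⟨Int.not_odd_iff_even.mpr hx, ?_⟩
      rcases Int.emod_two_eq_zero_or_one (k ^ 2) with h | h <;> rw [mul_pow] <;> omega
    · refine Or.inl ⟨hx, ?_⟩
      obtain ⟨k, rfl⟩ := hx
      obtain ⟨l, hl⟩ := (Int.even_mul_succ_self k).two_dvd
      rw [show (2 * k + 1) ^ 2 = 4 * (k * (k + 1)) + 1 by ring, hl]
      omega
  rcases hsq u with hu | hu <;> rcases hsq v with hv | hv <;> rcases hsq w with hw | hw <;>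
    first | exact ⟨hu.1, hv.1, hw.1⟩ | omega

theorem sum_three_triangular (n : ℕ) :
    ∃ a b c : ℕ, n = a * (a + 1) / 2 + b * (b + 1) / 2 + c * (c + 1) / 2 := by
  obtain ⟨u, v, w, h⟩ := eight_mul_add_three_eq_sum_three_sq n
  obtain ⟨hu, hv, hw⟩ := Int.odd_of_sum_three_sq_emod_eight_eq_three (u := u) (v := v) (w := w)
    (by omega)
  obtain ⟨a, ha⟩ := Int.exists_nat_sq_eq_two_mul_add_one_sq hu
  obtain ⟨b, hb⟩ := Int.exists_nat_sq_eq_two_mul_add_one_sq hv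
  obtain ⟨c, hc⟩ := Int.exists_nat_sq_eq_two_mul_add_one_sq hw
  refine ⟨a, b, c, ?_⟩
  have hsum : 2 * n = a * (a + 1) + b * (b + 1) + c * (c + 1) := by
    zify
    linarith
  have h₁ := Nat.even_mul_succ_self a
  have h₂ := Nat.even_mul_succ_self b
  have h₃ := Nat.even_mul_succ_self c
  rw [Nat.even_iff] at h₁ h₂ h₃
  omega
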